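/- Let k, ℓ ≥ 1 and let ρ_{A^kA^ℓ} be a state on (ℂ^{d_A})^{⊗(k+ℓ)} with marginal states ρ_{A^k} and ρ_{A^ℓ} obtained by partial trace over the last ℓ and first k tensor factors respectively. Then, writing I_c^{(n)} for the coherent information of the n-fold channel, I_c^{(k)}(ρ_{A^k}) + I_c^{(ℓ)}(ρ_{A^ℓ}) − I_c^{(k+ℓ)}(ρ_{A^kA^ℓ}) = D(N_B^{⊗(k+ℓ)}(ρ_{A^kA^ℓ}) ‖ N_B^{⊗k}(ρ_{A^k}) ⊗ N_B^{⊗ℓ}(ρ_{A^ℓ})) − D(N_E^{⊗(k+ℓ)}(ρ_{A^kA^ℓ}) ‖ N_E^{⊗k}(ρ_{A^k}) ⊗ N_E^{⊗ℓ}(ρ_{A^ℓ})), and both relative entropy terms are finite since the support of a bipartite state's output is contained in the support of the tensor product of its marginal outputs. -/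

import Mathlib

open Matrix BigOperators
open scoped ComplexOrder

noncomputable section

/-- Matrix logarithm via the spectral decomposition (junk value `0` off Hermitian matrices;
eigenvalue `0` contributes `Real.log 0 = 0`). -/
def matLog {n : Type*} [Fintype n] [DecidableEq n] (ρ : Matrix n n ℂ) : Matrix n n ℂ :=
  if h : ρ.IsHermitian then
    (h.eigenvectorUnitary : Matrix n n ℂ) *
      Matrix.diagonal (fun i => (Real.log (h.eigenvalues i) : ℂ)) *
      (h.eigenvectorUnitary : Matrix n n ℂ)ᴴ
  else 0

/-- Von Neumann entropy `H(ρ) = -Tr[ρ log ρ]`. -/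
def vnEntropy {n : Type*} [Fintype n] [DecidableEq n] (ρ : Matrix n n ℂ) : ℝ :=
  - (ρ * matLog ρ).trace.re

/-- Quantum relative entropy `D(ρ‖σ) = Tr[ρ (log ρ - log σ)]`. -/
def relEntropy {n : Type*} [Fintype n] [DecidableEq n] (ρ σ : Matrix n n ℂ) : ℝ :=
  (ρ * (matLog ρ - matLog σ)).trace.re

/-- A state: positive semidefinite with unit trace. -/
def IsState {n : Type*} [Fintype n] (ρ : Matrix n n ℂ) : Prop :=
  ρ.PosSemidef ∧ ρ.trace = 1

/-- A pure (rank-one) state `|ψ⟩⟨ψ|` for a unit vector `ψ`. -/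
def IsPureState {n : Type*} [Fintype n] (ρ : Matrix n n ℂ) : Prop :=
  ∃ ψ : n → ℂ, (∑ i, Complex.normSq (ψ i)) = 1 ∧ ρ = Matrix.vecMulVec ψ (star ψ)

/-- Support (range) inclusion for matrices. -/
def suppLE {n : Type*} [Fintype n] [DecidableEq n] (ρ σ : Matrix n n ℂ) : Prop :=
  LinearMap.range (Matrix.toLin' ρ) ≤ LinearMap.range (Matrix.toLin' σ)

/-- Partial trace over the second tensor factor. -/
def ptraceSnd {α β : Type*} [Fintype β] (M : Matrix (α × β) (α × β) ℂ) : Matrix α α ℂ :=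
  Matrix.of fun i j => ∑ k, M (i, k) (j, k)

/-- Partial trace over the first tensor factor. -/
def ptraceFst {α β : Type*} [Fintype α] (M : Matrix (α × β) (α × β) ℂ) : Matrix β β ℂ :=
  Matrix.of fun i j => ∑ k, M (k, i) (k, j)

variable {dA dB dE : ℕ}

/-- The channel `N_B(ρ) = Tr_E[U ρ U†]`. -/
def chanB (U : Matrix (Fin dB × Fin dE) (Fin dA) ℂ) (ρ : Matrix (Fin dA) (Fin dA) ℂ) :
    Matrix (Fin dB) (Fin dB) ℂ := ptraceSnd (U * ρ * Uᴴ)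

/-- The complementary channel `N_E(ρ) = Tr_B[U ρ U†]`. -/
def chanE (U : Matrix (Fin dB × Fin dE) (Fin dA) ℂ) (ρ : Matrix (Fin dA) (Fin dA) ℂ) :
    Matrix (Fin dE) (Fin dE) ℂ := ptraceFst (U * ρ * Uᴴ)

/-- Coherent information `I_c(ρ) = H(N_B(ρ)) - H(N_E(ρ))`. -/
def cohInfo (U : Matrix (Fin dB × Fin dE) (Fin dA) ℂ) (ρ : Matrix (Fin dA) (Fin dA) ℂ) : ℝ :=
  vnEntropy (chanB U ρ) - vnEntropy (chanE U ρ)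

/-- Holevo quantity of the ensemble `(p, σ)` with respect to the channel `N`. -/
def holevo {ι inn out : Type*} [Fintype ι] [Fintype out] [DecidableEq out]
    [AddCommMonoid (Matrix inn inn ℂ)]
    (N : Matrix inn inn ℂ → Matrix out out ℂ)
    (p : ι → ℝ) (σ : ι → Matrix inn inn ℂ) : ℝ :=
  vnEntropy (N (∑ u, (p u : ℂ) • σ u)) - ∑ u, p u * vnEntropy (N (σ u))

/-- A finite ensemble: a probability distribution together with states. -/
def IsEnsemble {ι inn : Type*} [Fintype ι] [Fintype inn]
    (p : ι → ℝ) (σ : ι → Matrix inn inn ℂ) : Prop :=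
  (∀ u, 0 ≤ p u) ∧ (∑ u, p u = 1) ∧ (∀ u, IsState (σ u))

/-- `Q^{(1)}`: optimized coherent information. -/
def Q1 (U : Matrix (Fin dB × Fin dE) (Fin dA) ℂ) : ℝ :=
  sSup { r | ∃ ρ, IsState ρ ∧ r = cohInfo U ρ }

/-- `C_p^{(1)}`: optimized difference of Holevo quantities. -/
def Cp1 (U : Matrix (Fin dB × Fin dE) (Fin dA) ℂ) : ℝ :=
  sSup { r | ∃ (m : ℕ) (p : Fin m → ℝ) (σ : Fin m → Matrix (Fin dA) (Fin dA) ℂ),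
    IsEnsemble p σ ∧ r = holevo (chanB U) p σ - holevo (chanE U) p σ }

/-- The `n`-fold tensor power `U^{⊗n}`, as a matrix from `(ℂ^{d_A})^{⊗n}`
to `(ℂ^{d_B})^{⊗n} ⊗ (ℂ^{d_E})^{⊗n}`. -/
def tensorPowIso (U : Matrix (Fin dB × Fin dE) (Fin dA) ℂ) (n : ℕ) :
    Matrix ((Fin n → Fin dB) × (Fin n → Fin dE)) (Fin n → Fin dA) ℂ :=
  Matrix.of fun be a => ∏ i, U (be.1 i, be.2 i) (a i)

/-- The `n`-fold channel `N_B^{⊗n}`. -/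
def chanBn (U : Matrix (Fin dB × Fin dE) (Fin dA) ℂ) (n : ℕ)
    (ρ : Matrix (Fin n → Fin dA) (Fin n → Fin dA) ℂ) :
    Matrix (Fin n → Fin dB) (Fin n → Fin dB) ℂ :=
  ptraceSnd (tensorPowIso U n * ρ * (tensorPowIso U n)ᴴ)

/-- The `n`-fold complementary channel `N_E^{⊗n}`. -/
def chanEn (U : Matrix (Fin dB × Fin dE) (Fin dA) ℂ) (n : ℕ)
    (ρ : Matrix (Fin n → Fin dA) (Fin n → Fin dA) ℂ) :
    Matrix (Fin n → Fin dE) (Fin n → Fin dE) ℂ :=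
  ptraceFst (tensorPowIso U n * ρ * (tensorPowIso U n)ᴴ)

/-- Coherent information of the `n`-fold channel. -/
def cohInfoN (U : Matrix (Fin dB × Fin dE) (Fin dA) ℂ) (n : ℕ)
    (ρ : Matrix (Fin n → Fin dA) (Fin n → Fin dA) ℂ) : ℝ :=
  vnEntropy (chanBn U n ρ) - vnEntropy (chanEn U n ρ)

/-- `Q^{(1)}(N_B^{⊗n})`. -/
def Q1n (U : Matrix (Fin dB × Fin dE) (Fin dA) ℂ) (n : ℕ) : ℝ :=
  sSup { r | ∃ ρ, IsState ρ ∧ r = cohInfoN U n ρ }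

/-- `C_p^{(1)}(N_B^{⊗n})`. -/
def Cp1n (U : Matrix (Fin dB × Fin dE) (Fin dA) ℂ) (n : ℕ) : ℝ :=
  sSup { r | ∃ (m : ℕ) (p : Fin m → ℝ)
    (σ : Fin m → Matrix (Fin n → Fin dA) (Fin n → Fin dA) ℂ),
    IsEnsemble p σ ∧ r = holevo (chanBn U n) p σ - holevo (chanEn U n) p σ }

/-- Quantum capacity `Q(N_B) = sup_{n ≥ 1} Q^{(1)}(N_B^{⊗n}) / n`. -/
def Qcap (U : Matrix (Fin dB × Fin dE) (Fin dA) ℂ) : ℝ :=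
  sSup { r | ∃ n : ℕ, 1 ≤ n ∧ r = Q1n U n / n }

/-- Private capacity `C_p(N_B) = sup_{n ≥ 1} C_p^{(1)}(N_B^{⊗n}) / n`. -/
def Cpcap (U : Matrix (Fin dB × Fin dE) (Fin dA) ℂ) : ℝ :=
  sSup { r | ∃ n : ℕ, 1 ≤ n ∧ r = Cp1n U n / n }
/-- Splitting `(Fin (k+l) → X)` into the first `k` and the last `l` tensor factors. -/
def splitEquiv (k l : ℕ) (X : Type*) : (Fin (k + l) → X) ≃ (Fin k → X) × (Fin l → X) :=
  (Equiv.arrowCongr finSumFinEquiv.symm (Equiv.refl X)).trans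
    (Equiv.sumArrowEquivProdArrow _ _ X)

section aux
variable {n m : Type*} [Fintype n] [DecidableEq n] [Fintype m] [DecidableEq m]

lemma aux_fun_unique (V W : Matrix n n ℂ) (hV : Vᴴ * V = 1) (hW : Wᴴ * W = 1) (d e : n → ℝ)
    (f : ℝ → ℝ)
    (h : V * diagonal (fun i => (d i : ℂ)) * Vᴴ = W * diagonal (fun i => (e i : ℂ)) * Wᴴ) :
    V * diagonal (fun i => (f (d i) : ℂ)) * Vᴴ = W * diagonal (fun i => (f (e i) : ℂ)) * Wᴴ := by
  have hV' : V * Vᴴ = 1 := mul_eq_one_comm.mp hV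
  have hW' : W * Wᴴ = 1 := mul_eq_one_comm.mp hW
  have h1 : (Wᴴ * V) * diagonal (fun i => (d i : ℂ)) = diagonal (fun i => (e i : ℂ)) * (Wᴴ * V) := by
    have : Wᴴ * (V * diagonal (fun i => (d i : ℂ)) * Vᴴ) * V
      = Wᴴ * (W * diagonal (fun i => (e i : ℂ)) * Wᴴ) * V := by rw [h]
    calc _ = Wᴴ * (V * diagonal (fun i => (d i : ℂ)) * Vᴴ) * V := by
            simp only [Matrix.mul_assoc, hV, Matrix.mul_one]
      _ = _ := this
      _ = (Wᴴ * W) * diagonal (fun i => (e i : ℂ)) * Wᴴ * V := by simp only [Matrix.mul_assoc]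
      _ = _ := by rw [hW, Matrix.one_mul, Matrix.mul_assoc]
  have h2 : (Wᴴ * V) * diagonal (fun i => (f (d i) : ℂ))
      = diagonal (fun i => (f (e i) : ℂ)) * (Wᴴ * V) := by
    ext i j
    have := congrFun (congrFun h1 i) j
    rw [mul_diagonal, diagonal_mul] at this ⊢
    by_cases hx : (Wᴴ * V) i j = 0
    · simp [hx]
    · rw [mul_comm] at this
      have h3 := mul_right_cancel₀ hx this
      have h4 : d j = e i := by exact_mod_cast h3
      rw [h4, mul_comm]
  calc V * diagonal (fun i => (f (d i) : ℂ)) * Vᴴ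
      = (W * Wᴴ) * V * diagonal (fun i => (f (d i) : ℂ)) * Vᴴ := by rw [hW', Matrix.one_mul]
    _ = W * ((Wᴴ * V) * diagonal (fun i => (f (d i) : ℂ))) * Vᴴ := by
        simp only [Matrix.mul_assoc]
    _ = W * (diagonal (fun i => (f (e i) : ℂ))) * Wᴴ * (V * Vᴴ) := by
        rw [h2]; simp only [Matrix.mul_assoc]
    _ = _ := by rw [hV', Matrix.mul_one]

lemma aux_spec {ρ : Matrix n n ℂ} (h : ρ.IsHermitian) :
    ∃ (V : Matrix n n ℂ) (d : n → ℝ), Vᴴ * V = 1 ∧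
      ρ = V * diagonal (fun i => (d i : ℂ)) * Vᴴ ∧
      matLog ρ = V * diagonal (fun i => (Real.log (d i) : ℂ)) * Vᴴ := by
  refine ⟨h.eigenvectorUnitary, h.eigenvalues, ?_, ?_, ?_⟩
  · exact (Matrix.mem_unitaryGroup_iff'.mp h.eigenvectorUnitary.2)
  · have := h.spectral_theorem
    rw [Unitary.conjStarAlgAut_apply] at this
    exact this
  · rw [matLog, dif_pos h]

lemma aux_herm (V : Matrix n n ℂ) (d : n → ℝ) :
    (V * diagonal (fun i => (d i : ℂ)) * Vᴴ).IsHermitian := by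
  rw [Matrix.IsHermitian]
  simp only [conjTranspose_mul, conjTranspose_conjTranspose, diagonal_conjTranspose, Matrix.mul_assoc]
  congr 3
  ext i
  simp

lemma aux_matLog {ρ : Matrix n n ℂ} (V : Matrix n n ℂ) (d : n → ℝ) (hV : Vᴴ * V = 1)
    (h : ρ = V * diagonal (fun i => (d i : ℂ)) * Vᴴ) :
    matLog ρ = V * diagonal (fun i => (Real.log (d i) : ℂ)) * Vᴴ := by
  obtain ⟨W, e, hW, h1, h2⟩ := aux_spec (h ▸ aux_herm V d : ρ.IsHermitian)
  rw [h2]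
  exact aux_fun_unique W V hW hV e d Real.log (h1.symm.trans h)

lemma aux_entropy {ρ : Matrix n n ℂ} (V : Matrix n n ℂ) (d : n → ℝ) (hV : Vᴴ * V = 1)
    (h : ρ = V * diagonal (fun i => (d i : ℂ)) * Vᴴ) :
    vnEntropy ρ = - ∑ i, d i * Real.log (d i) := by
  have : ρ * matLog ρ = V * (diagonal (fun i => (d i : ℂ)) * diagonal (fun i => (Real.log (d i) : ℂ))) * Vᴴ := by
    rw [aux_matLog V d hV h]
    nth_rw 1 [h]
    calc _ = V * diagonal (fun i => (d i : ℂ)) * (Vᴴ * V) * diagonal (fun i => (Real.log (d i) : ℂ)) * Vᴴ := by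
          simp only [Matrix.mul_assoc]
      _ = _ := by rw [hV]; simp only [Matrix.mul_assoc, Matrix.one_mul]
  rw [vnEntropy, this, Matrix.trace_mul_comm, ← Matrix.mul_assoc, hV, Matrix.one_mul,
    diagonal_mul_diagonal, trace_diagonal, Complex.re_sum]
  congr 1
  refine Finset.sum_congr rfl fun i _ => ?_
  rw [← Complex.ofReal_mul, Complex.ofReal_re]

lemma aux_entropy_reindex {ρ : Matrix n n ℂ} (h : ρ.IsHermitian) (e : n ≃ m) :
    vnEntropy (Matrix.reindex e e ρ) = vnEntropy ρ := by
  obtain ⟨V, d, hV, h1, -⟩ := aux_spec h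
  rw [aux_entropy V d hV h1, aux_entropy (V.submatrix e.symm e.symm) (d ∘ e.symm)]
  · congr 1
    exact Equiv.sum_comp e.symm (fun i => d i * Real.log (d i))
  · rw [conjTranspose_submatrix, submatrix_mul_equiv, hV, submatrix_one_equiv]
  · have : (diagonal (fun i => (((d ∘ e.symm) i : ℝ) : ℂ)))
        = (diagonal (fun i => (d i : ℂ))).submatrix e.symm e.symm := by
      rw [submatrix_diagonal_equiv]; rfl
    rw [this, conjTranspose_submatrix, submatrix_mul_equiv, submatrix_mul_equiv, ← h1]
    rfl

lemma aux_psd_zero {M : Matrix n n ℂ} (hM : M.PosSemidef) (i j : n) (h : M i i = 0) : M i j = 0 := by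
  obtain ⟨B, rfl⟩ : ∃ B : Matrix n n ℂ, M = Bᴴ * B := by
    open scoped MatrixOrder in
    exact CStarAlgebra.nonneg_iff_eq_star_mul_self.mp hM.nonneg
  have hB : ∀ k, B k i = 0 := by
    rw [Matrix.mul_apply] at h
    have h' : ∑ k, Complex.normSq (B k i) = 0 := by
      have : ((∑ k, Complex.normSq (B k i) : ℝ) : ℂ) = 0 := by
        rw [← h]; push_cast
        refine Finset.sum_congr rfl fun k _ => ?_
        rw [Complex.normSq_eq_conj_mul_self]; rfl
      exact_mod_cast this
    intro k
    rw [Finset.sum_eq_zero_iff_of_nonneg (fun _ _ => Complex.normSq_nonneg _)] at h'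
    exact Complex.normSq_eq_zero.mp (h' k (Finset.mem_univ _))
  rw [Matrix.mul_apply]
  refine Finset.sum_eq_zero fun k _ => ?_
  simp [hB k]

lemma aux_ptSnd_conj (V : Matrix n n ℂ) (W : Matrix m m ℂ) (hW : Wᴴ * W = 1)
    (M : Matrix (n × m) (n × m) ℂ) :
    ptraceSnd ((kroneckerMap (· * ·) V W)ᴴ * M * kroneckerMap (· * ·) V W)
      = Vᴴ * ptraceSnd M * V := by
  have hW' : W * Wᴴ = 1 := mul_eq_one_comm.mp hW
  have key : ∀ b b', ∑ j, star (W b j) * W b' j = if b' = b then 1 else 0 := by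
    intro b b'
    have := congrFun (congrFun hW' b') b
    rw [Matrix.mul_apply, Matrix.one_apply] at this
    rw [← this]
    exact Finset.sum_congr rfl fun j _ => by rw [conjTranspose_apply, mul_comm]
  ext i i'
  have e1 : ptraceSnd ((kroneckerMap (· * ·) V W)ᴴ * M * kroneckerMap (· * ·) V W) i i'
      = ∑ j, ∑ a', ∑ b', ∑ a, ∑ b, star (V a i) * M (a, b) (a', b') * V a' i' *
        (star (W b j) * W b' j) := by
    simp only [ptraceSnd, of_apply, Matrix.mul_apply, Fintype.sum_prod_type, Finset.sum_mul,
      conjTranspose_apply, kroneckerMap_apply]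
    refine Finset.sum_congr rfl fun j _ => Finset.sum_congr rfl fun _ _ => Finset.sum_congr rfl fun _ _ => Finset.sum_congr rfl fun _ _ => Finset.sum_congr rfl fun _ _ => ?_
    rw [star_mul']; ring
  have e2 : (Vᴴ * ptraceSnd M * V) i i'
      = ∑ a', ∑ a, ∑ b, star (V a i) * M (a, b) (a', b) * V a' i' := by
    simp only [ptraceSnd, of_apply, Matrix.mul_apply, Finset.sum_mul, Finset.mul_sum,
      conjTranspose_apply]
  rw [e1, e2, Finset.sum_comm]
  refine Finset.sum_congr rfl fun a' _ => ?_
  rw [Finset.sum_comm]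
  simp_rw [Finset.sum_comm (s := (Finset.univ : Finset m)) (t := (Finset.univ : Finset n))]
  refine Finset.sum_congr rfl fun a _ => ?_
  rw [Finset.sum_congr rfl fun b' _ => Finset.sum_comm]
  simp_rw [← Finset.mul_sum, key]
  simp

lemma aux_ptFst_conj (V : Matrix n n ℂ) (W : Matrix m m ℂ) (hV : Vᴴ * V = 1)
    (M : Matrix (n × m) (n × m) ℂ) :
    ptraceFst ((kroneckerMap (· * ·) V W)ᴴ * M * kroneckerMap (· * ·) V W)
      = Wᴴ * ptraceFst M * W := by
  have h := aux_ptSnd_conj W V hV (M.submatrix Prod.swap Prod.swap)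
  have h1 : ptraceSnd (M.submatrix Prod.swap Prod.swap) = ptraceFst M := rfl
  rw [h1] at h
  rw [← h]
  have h2 : (kroneckerMap (· * ·) W V : Matrix (m × n) (m × n) ℂ)
      = (kroneckerMap (· * ·) V W).submatrix (Equiv.prodComm m n) (Equiv.prodComm m n) := by
    ext ⟨a, b⟩ ⟨c, d⟩
    simp [mul_comm]
  rw [h2]
  change _ = ptraceSnd ((submatrix _ _ _)ᴴ * (M.submatrix (Equiv.prodComm m n) (Equiv.prodComm m n)) * _)
  rw [conjTranspose_submatrix, submatrix_mul_equiv, submatrix_mul_equiv]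
  rfl

lemma aux_main (M : Matrix (n × m) (n × m) ℂ) (hM : M.PosSemidef)
    (a : Matrix n n ℂ) (b : Matrix m m ℂ) (ha : a = ptraceSnd M) (hb : b = ptraceFst M) :
    suppLE M (kroneckerMap (· * ·) a b) ∧
    relEntropy M (kroneckerMap (· * ·) a b) = vnEntropy a + vnEntropy b - vnEntropy M := by
  have haH : a.IsHermitian := by
    ext i j
    simp only [ha, ptraceSnd, conjTranspose_apply, of_apply, star_sum]
    exact Finset.sum_congr rfl fun k _ => hM.1.apply _ _
  have hbH : b.IsHermitian := by
    ext i j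
    simp only [hb, ptraceFst, conjTranspose_apply, of_apply, star_sum]
    exact Finset.sum_congr rfl fun k _ => hM.1.apply _ _
  obtain ⟨V, p, hV, hVa, -⟩ := aux_spec haH
  obtain ⟨W, q, hW, hWb, -⟩ := aux_spec hbH
  set Q : Matrix (n × m) (n × m) ℂ := kroneckerMap (· * ·) V W with hQdef
  have hQH : Qᴴ = kroneckerMap (· * ·) Vᴴ Wᴴ := conjTranspose_kronecker V W
  have hQ : Qᴴ * Q = 1 := by
    rw [hQH, hQdef]
    have := Matrix.mul_kronecker_mul Vᴴ V Wᴴ W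
    rw [hV, hW] at this
    exact this.symm.trans Matrix.one_kronecker_one
  have hQ' : Q * Qᴴ = 1 := mul_eq_one_comm.mp hQ
  set d : n × m → ℝ := fun x => p x.1 * q x.2 with hd
  have hab : (kroneckerMap (· * ·) a b : Matrix (n × m) (n × m) ℂ)
      = Q * diagonal (fun i => (d i : ℂ)) * Qᴴ := by
    rw [hQH, hQdef]
    have h1 := Matrix.mul_kronecker_mul (V * diagonal (fun i => (p i : ℂ))) Vᴴ (W * diagonal (fun i => (q i : ℂ))) Wᴴ
    have h2 := Matrix.mul_kronecker_mul V (diagonal (fun i => (p i : ℂ))) W (diagonal (fun i => (q i : ℂ)))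
    rw [h2, Matrix.diagonal_kronecker_diagonal, ← hVa, ← hWb] at h1
    simp only [hd, Complex.ofReal_mul]
    exact h1
  set M' := Qᴴ * M * Q with hM'
  have hM'psd : M'.PosSemidef := hM.conjTranspose_mul_mul_same Q
  have hMM' : M = Q * M' * Qᴴ := by
    calc M = (Q * Qᴴ) * M * (Q * Qᴴ) := by rw [hQ']; simp
      _ = _ := by simp only [hM', Matrix.mul_assoc]
  have hp : ptraceSnd M' = diagonal (fun i => (p i : ℂ)) := by
    rw [hM', hQdef, aux_ptSnd_conj V W hW, ← ha, hVa]
    calc _ = (Vᴴ * V) * diagonal (fun i => (p i : ℂ)) * (Vᴴ * V) := by simp only [Matrix.mul_assoc]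
      _ = _ := by rw [hV]; simp
  have hq : ptraceFst M' = diagonal (fun i => (q i : ℂ)) := by
    rw [hM', hQdef, aux_ptFst_conj V W hV, ← hb, hWb]
    calc _ = (Wᴴ * W) * diagonal (fun i => (q i : ℂ)) * (Wᴴ * W) := by simp only [Matrix.mul_assoc]
      _ = _ := by rw [hW]; simp
  have hre : ∀ x, M' x x = ((M' x x).re : ℂ) := fun x =>
    (Complex.nonneg_iff.mp (hM'psd.diag_nonneg (i := x))) |> fun h =>
      Complex.ext (by simp) (by simp [h.2.symm])
  have hnn : ∀ x, 0 ≤ (M' x x).re := fun x =>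
    (Complex.nonneg_iff.mp (hM'psd.diag_nonneg (i := x))).1
  have hp' : ∀ i, ∑ j, (M' (i, j) (i, j)).re = p i := by
    intro i
    have := congrArg Complex.re (congrFun (congrFun hp i) i)
    simpa [ptraceSnd] using this
  have hq' : ∀ j, ∑ i, (M' (i, j) (i, j)).re = q j := by
    intro j
    have := congrArg Complex.re (congrFun (congrFun hq j) j)
    simpa [ptraceFst] using this
  have hz1 : ∀ x : n × m, p x.1 = 0 → (M' x x).re = 0 := by
    rintro ⟨i, j⟩ h
    have h2 := hp' i
    rw [show p i = 0 from h, Finset.sum_eq_zero_iff_of_nonneg (fun _ _ => hnn _)] at h2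
    exact h2 j (Finset.mem_univ _)
  have hz2 : ∀ x : n × m, q x.2 = 0 → (M' x x).re = 0 := by
    rintro ⟨i, j⟩ h
    have h2 := hq' j
    rw [show q j = 0 from h, Finset.sum_eq_zero_iff_of_nonneg (fun _ _ => hnn _)] at h2
    exact h2 i (Finset.mem_univ _)
  have hz : ∀ x : n × m, d x = 0 → (M' x x).re = 0 := fun x h =>
    (mul_eq_zero.mp h).elim (hz1 x) (hz2 x)
  constructor
  · have hX : M' = diagonal (fun i => (d i : ℂ)) * (diagonal (fun i => ((d i)⁻¹ : ℂ)) * M') := by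
      ext x y
      rw [diagonal_mul, diagonal_mul]
      by_cases h : d x = 0
      · have : M' x y = 0 := aux_psd_zero hM'psd x y (by rw [hre, hz x h]; simp)
        rw [this]; simp
      · have : (d x : ℂ) ≠ 0 := by exact_mod_cast h
        rw [mul_inv_cancel_left₀ this]
    have hY : M = kroneckerMap (· * ·) a b * (Q * (diagonal (fun i => ((d i)⁻¹ : ℂ)) * M') * Qᴴ) := by
      rw [hab]
      calc M = Q * M' * Qᴴ := hMM'
        _ = Q * (diagonal (fun i => (d i : ℂ)) * (diagonal (fun i => ((d i)⁻¹ : ℂ)) * M')) * Qᴴ := by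
            rw [← hX]
        _ = Q * diagonal (fun i => (d i : ℂ)) * (Qᴴ * Q) * (diagonal (fun i => ((d i)⁻¹ : ℂ)) * M') * Qᴴ := by
            rw [hQ]; simp only [Matrix.mul_assoc, Matrix.one_mul]
        _ = _ := by simp only [Matrix.mul_assoc]
    rw [suppLE, hY, Matrix.toLin'_mul]
    exact LinearMap.range_comp_le_range _ _
  · have hlog := aux_matLog Q d hQ hab
    have ht : (M * matLog (kroneckerMap (· * ·) a b)).trace.re
        = ∑ x, (M' x x).re * Real.log (d x) := by
      rw [hlog]
      have : (M * (Q * diagonal (fun i => (Real.log (d i) : ℂ)) * Qᴴ)).trace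
          = (M' * diagonal (fun i => (Real.log (d i) : ℂ))).trace := by
        rw [← Matrix.mul_assoc, Matrix.trace_mul_comm]
        simp only [hM', Matrix.mul_assoc]
      rw [this, Matrix.trace, Complex.re_sum]
      refine Finset.sum_congr rfl fun x _ => ?_
      rw [diag_apply, mul_diagonal, Complex.re_mul_ofReal]
    have hs : ∑ x, (M' x x).re * Real.log (d x)
        = ∑ i, p i * Real.log (p i) + ∑ j, q j * Real.log (q j) := by
      have : ∀ x, (M' x x).re * Real.log (d x)
          = (M' x x).re * Real.log (p x.1) + (M' x x).re * Real.log (q x.2) := by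
        intro x
        by_cases h1 : p x.1 = 0
        · simp [hz1 x h1]
        by_cases h2 : q x.2 = 0
        · simp [hz2 x h2]
        rw [hd, Real.log_mul h1 h2, mul_add]
      simp_rw [this]
      rw [Finset.sum_add_distrib, Fintype.sum_prod_type, Fintype.sum_prod_type_right]
      congr 1
      · exact Finset.sum_congr rfl fun i _ => by rw [← hp' i, Finset.sum_mul]; simp only [hp']
      · exact Finset.sum_congr rfl fun i _ => by rw [← hq' i, Finset.sum_mul]; simp only [hq']
    rw [relEntropy, Matrix.mul_sub, Matrix.trace_sub, Complex.sub_re, ht, hs,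
      aux_entropy V p hV hVa, aux_entropy W q hW hWb, vnEntropy]
    ring

end aux

section chan
variable {A1 A2 B1 B2 E1 E2 : Type*} [Fintype A1] [Fintype A2] [Fintype B1] [Fintype B2]
  [Fintype E1] [Fintype E2] [DecidableEq A1] [DecidableEq A2]

/-- Product isometry. -/
def auxProd (V : Matrix (B1 × E1) A1 ℂ) (W : Matrix (B2 × E2) A2 ℂ) :
    Matrix ((B1 × B2) × (E1 × E2)) (A1 × A2) ℂ :=
  Matrix.of fun x a => V (x.1.1, x.2.1) a.1 * W (x.1.2, x.2.2) a.2

lemma aux_iso_key (W : Matrix (B2 × E2) A2 ℂ) (hW : Wᴴ * W = 1) (c c' : A2) :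
    ∑ j, ∑ e, W (j, e) c * star (W (j, e) c') = if c = c' then 1 else 0 := by
  have := congrFun (congrFun hW c') c
  rw [Matrix.mul_apply, Matrix.one_apply, Fintype.sum_prod_type] at this
  simp only [eq_comm (a := c)]
  rw [← this]
  exact Finset.sum_congr rfl fun j _ => Finset.sum_congr rfl fun j _ => by
    rw [conjTranspose_apply, mul_comm]

lemma aux_margSnd (V : Matrix (B1 × E1) A1 ℂ) (W : Matrix (B2 × E2) A2 ℂ) (hW : Wᴴ * W = 1)
    (ρ : Matrix (A1 × A2) (A1 × A2) ℂ) :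
    ptraceSnd (ptraceSnd (auxProd V W * ρ * (auxProd V W)ᴴ))
      = ptraceSnd (V * ptraceSnd ρ * Vᴴ) := by
  ext i i'
  have e1 : ptraceSnd (ptraceSnd (auxProd V W * ρ * (auxProd V W)ᴴ)) i i'
      = ∑ j, ∑ e1, ∑ e2, ∑ a', ∑ c', ∑ a, ∑ c, V (i, e1) a * ρ (a, c) (a', c') * star (V (i', e1) a')
        * (W (j, e2) c * star (W (j, e2) c')) := by
    simp only [ptraceSnd, of_apply, Matrix.mul_apply, Fintype.sum_prod_type, Finset.sum_mul,
      conjTranspose_apply, auxProd]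
    refine Finset.sum_congr rfl fun j _ => Finset.sum_congr rfl fun _ _ => Finset.sum_congr rfl fun _ _ => Finset.sum_congr rfl fun _ _ => Finset.sum_congr rfl fun _ _ => Finset.sum_congr rfl fun _ _ => Finset.sum_congr rfl fun _ _ => ?_
    rw [star_mul']; ring
  have e2 : ptraceSnd (V * ptraceSnd ρ * Vᴴ) i i'
      = ∑ e1, ∑ a', ∑ a, ∑ c, V (i, e1) a * ρ (a, c) (a', c) * star (V (i', e1) a') := by
    simp only [ptraceSnd, of_apply, Matrix.mul_apply, Finset.sum_mul, Finset.mul_sum,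
      conjTranspose_apply]
  rw [e1, e2, Finset.sum_comm]
  refine Finset.sum_congr rfl fun e1 _ => ?_
  rw [← Fintype.sum_prod_type', Finset.sum_comm]
  refine Finset.sum_congr rfl fun a' _ => ?_
  rw [Finset.sum_comm]
  rw [Finset.sum_congr rfl fun c' _ => Finset.sum_comm]
  rw [Finset.sum_comm]
  refine Finset.sum_congr rfl fun a _ => ?_
  rw [Finset.sum_congr rfl fun c' _ => Finset.sum_comm]
  rw [Finset.sum_comm]
  refine Finset.sum_congr rfl fun c _ => ?_
  simp_rw [← Finset.mul_sum, Fintype.sum_prod_type, aux_iso_key W hW]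
  simp

lemma aux_margFst (V : Matrix (B1 × E1) A1 ℂ) (W : Matrix (B2 × E2) A2 ℂ) (hV : Vᴴ * V = 1)
    (ρ : Matrix (A1 × A2) (A1 × A2) ℂ) :
    ptraceFst (ptraceSnd (auxProd V W * ρ * (auxProd V W)ᴴ))
      = ptraceSnd (W * ptraceFst ρ * Wᴴ) := by
  have h := aux_margSnd W V hV (ρ.submatrix Prod.swap Prod.swap)
  have h1 : ptraceSnd (ρ.submatrix Prod.swap Prod.swap) = ptraceFst ρ := rfl
  rw [h1] at h
  rw [← h]
  have h2 : auxProd W V = (auxProd V W).submatrix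
      ((Equiv.prodComm B2 B1).prodCongr (Equiv.prodComm E2 E1)) (Equiv.prodComm A2 A1) := by
    ext x y
    simp [auxProd, mul_comm]
  rw [h2]
  change _ = ptraceSnd (ptraceSnd (_ * (ρ.submatrix (Equiv.prodComm A2 A1) (Equiv.prodComm A2 A1)) * _))
  rw [conjTranspose_submatrix, submatrix_mul_equiv, submatrix_mul_equiv]
  ext i i'
  simp only [ptraceFst, ptraceSnd, of_apply, submatrix_apply]
  refine Finset.sum_congr rfl fun j _ => ?_
  exact (Equiv.sum_comp (Equiv.prodComm E2 E1) _).symm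

end chan

lemma aux_tensorPow_iso (U : Matrix (Fin dB × Fin dE) (Fin dA) ℂ) (hU : Uᴴ * U = 1) (n : ℕ) :
    (tensorPowIso U n)ᴴ * tensorPowIso U n = 1 := by
  ext a a'
  rw [Matrix.mul_apply, ← Equiv.sum_comp (Equiv.arrowProdEquivProdArrow (Fin n) (fun _ => Fin dB) (fun _ => Fin dE))]
  have : ∀ i, ∑ x, star (U x (a i)) * U x (a' i) = if a i = a' i then 1 else 0 := by
    intro i
    have := congrFun (congrFun hU (a i)) (a' i)
    rwa [Matrix.mul_apply, Matrix.one_apply] at this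
  calc _ = ∑ f : Fin n → Fin dB × Fin dE, ∏ i, (star (U (f i) (a i)) * U (f i) (a' i)) := by
        refine Finset.sum_congr rfl fun f _ => ?_
        simp [tensorPowIso, Finset.prod_mul_distrib]
    _ = ∏ i, ∑ x, star (U x (a i)) * U x (a' i) := by
        rw [Finset.prod_univ_sum, Fintype.piFinset_univ]
    _ = _ := by
        simp_rw [this]
        rw [Matrix.one_apply]
        by_cases h : a = a'
        · simp [h]
        · rw [if_neg h]
          obtain ⟨i, hi⟩ := Function.ne_iff.mp h
          exact Finset.prod_eq_zero (Finset.mem_univ i) (if_neg hi)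

lemma aux_tensorPow_split (U : Matrix (Fin dB × Fin dE) (Fin dA) ℂ) (k l : ℕ) :
    (tensorPowIso U (k + l)) = (auxProd (tensorPowIso U k) (tensorPowIso U l)).submatrix
      ((splitEquiv k l (Fin dB)).prodCongr (splitEquiv k l (Fin dE))) (splitEquiv k l (Fin dA)) := by
  ext x a
  simp only [tensorPowIso, auxProd, of_apply, submatrix_apply, Fin.prod_univ_add]
  rfl

lemma aux_chan_split (U : Matrix (Fin dB × Fin dE) (Fin dA) ℂ) (k l : ℕ)
    (ρ : Matrix (Fin (k + l) → Fin dA) (Fin (k + l) → Fin dA) ℂ) :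
    Matrix.reindex (splitEquiv k l (Fin dB)) (splitEquiv k l (Fin dB)) (chanBn U (k + l) ρ)
      = ptraceSnd (auxProd (tensorPowIso U k) (tensorPowIso U l) *
        (Matrix.reindex (splitEquiv k l (Fin dA)) (splitEquiv k l (Fin dA)) ρ) *
        (auxProd (tensorPowIso U k) (tensorPowIso U l))ᴴ) := by
  have hρ : ρ = (Matrix.reindex (splitEquiv k l (Fin dA)) (splitEquiv k l (Fin dA)) ρ).submatrix
      (splitEquiv k l (Fin dA)) (splitEquiv k l (Fin dA)) := by
    ext; simp
  rw [chanBn, aux_tensorPow_split]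
  nth_rw 1 [hρ]
  rw [conjTranspose_submatrix, submatrix_mul_equiv, submatrix_mul_equiv]
  ext i i'
  simp only [ptraceSnd, of_apply, submatrix_apply, reindex_apply, Equiv.prodCongr_apply, Prod.map,
    Equiv.apply_symm_apply]
  exact Equiv.sum_comp (splitEquiv k l (Fin dE)) (fun e => (auxProd (tensorPowIso U k) (tensorPowIso U l) *
        (ρ.submatrix (splitEquiv k l (Fin dA)).symm (splitEquiv k l (Fin dA)).symm) *
        (auxProd (tensorPowIso U k) (tensorPowIso U l))ᴴ) (i, e) (i', e))

lemma aux_chan_psd (U : Matrix (Fin dB × Fin dE) (Fin dA) ℂ) (n : ℕ)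
    (ρ : Matrix (Fin n → Fin dA) (Fin n → Fin dA) ℂ) (hρ : ρ.PosSemidef) :
    (chanBn U n ρ).PosSemidef := by
  have h := hρ.mul_mul_conjTranspose_same (tensorPowIso U n)
  have : chanBn U n ρ = ∑ e, (tensorPowIso U n * ρ * (tensorPowIso U n)ᴴ).submatrix
      (fun b => (b, e)) (fun b => (b, e)) := by
    ext i j
    simp [chanBn, ptraceSnd, Matrix.sum_apply]
  rw [this]
  exact Matrix.posSemidef_sum _ fun e _ => h.submatrix _

lemma aux_B (U : Matrix (Fin dB × Fin dE) (Fin dA) ℂ) (hU : Uᴴ * U = 1) (k l : ℕ)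
    (ρ : Matrix (Fin (k + l) → Fin dA) (Fin (k + l) → Fin dA) ℂ) (hρ : ρ.PosSemidef)
    (ρk : Matrix (Fin k → Fin dA) (Fin k → Fin dA) ℂ)
    (ρl : Matrix (Fin l → Fin dA) (Fin l → Fin dA) ℂ)
    (hρk : ρk = ptraceSnd (Matrix.reindex (splitEquiv k l (Fin dA))
      (splitEquiv k l (Fin dA)) ρ))
    (hρl : ρl = ptraceFst (Matrix.reindex (splitEquiv k l (Fin dA))
      (splitEquiv k l (Fin dA)) ρ)) :
    suppLE (Matrix.reindex (splitEquiv k l (Fin dB)) (splitEquiv k l (Fin dB))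
        (chanBn U (k + l) ρ))
      (Matrix.kroneckerMap (· * ·) (chanBn U k ρk) (chanBn U l ρl))
    ∧ relEntropy
          (Matrix.reindex (splitEquiv k l (Fin dB)) (splitEquiv k l (Fin dB))
            (chanBn U (k + l) ρ))
          (Matrix.kroneckerMap (· * ·) (chanBn U k ρk) (chanBn U l ρl))
      = vnEntropy (chanBn U k ρk) + vnEntropy (chanBn U l ρl) - vnEntropy (chanBn U (k + l) ρ) := by
  have hp := aux_chan_psd U (k + l) ρ hρ
  have h := aux_main (Matrix.reindex (splitEquiv k l (Fin dB)) (splitEquiv k l (Fin dB))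
            (chanBn U (k + l) ρ)) (hp.submatrix _) (chanBn U k ρk) (chanBn U l ρl)
    (by rw [aux_chan_split, aux_margSnd _ _ (aux_tensorPow_iso U hU l), ← hρk]; rfl)
    (by rw [aux_chan_split, aux_margFst _ _ (aux_tensorPow_iso U hU k), ← hρl]; rfl)
  rw [aux_entropy_reindex hp.1] at h
  exact h

lemma aux_E (U : Matrix (Fin dB × Fin dE) (Fin dA) ℂ) (n : ℕ) :
    chanEn U n = chanBn (U.submatrix (Equiv.prodComm (Fin dE) (Fin dB)) id) n := rfl

/-- For a state `ρ_{A^kA^ℓ}` with marginals `ρ_{A^k}`, `ρ_{A^ℓ}`,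
the superadditivity defect of the coherent information equals the difference of the
relative entropies of the joint outputs relative to the product of marginal outputs,
and both relative entropy terms are finite (support containment holds). -/
theorem cohInfo_superadditivity_defect
    {dA dB dE : ℕ} (hdA : 1 ≤ dA) (hdB : 1 ≤ dB) (hdE : 1 ≤ dE)
    (U : Matrix (Fin dB × Fin dE) (Fin dA) ℂ) (hU : Uᴴ * U = 1)
    (k l : ℕ) (hk : 1 ≤ k) (hl : 1 ≤ l)
    (ρ : Matrix (Fin (k + l) → Fin dA) (Fin (k + l) → Fin dA) ℂ) (hρ : IsState ρ)
    (ρk : Matrix (Fin k → Fin dA) (Fin k → Fin dA) ℂ)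
    (ρl : Matrix (Fin l → Fin dA) (Fin l → Fin dA) ℂ)
    (hρk : ρk = ptraceSnd (Matrix.reindex (splitEquiv k l (Fin dA))
      (splitEquiv k l (Fin dA)) ρ))
    (hρl : ρl = ptraceFst (Matrix.reindex (splitEquiv k l (Fin dA))
      (splitEquiv k l (Fin dA)) ρ)) :
    suppLE (Matrix.reindex (splitEquiv k l (Fin dB)) (splitEquiv k l (Fin dB))
        (chanBn U (k + l) ρ))
      (Matrix.kroneckerMap (· * ·) (chanBn U k ρk) (chanBn U l ρl))
    ∧ suppLE (Matrix.reindex (splitEquiv k l (Fin dE)) (splitEquiv k l (Fin dE))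
        (chanEn U (k + l) ρ))
      (Matrix.kroneckerMap (· * ·) (chanEn U k ρk) (chanEn U l ρl))
    ∧ cohInfoN U k ρk + cohInfoN U l ρl - cohInfoN U (k + l) ρ
      = relEntropy
          (Matrix.reindex (splitEquiv k l (Fin dB)) (splitEquiv k l (Fin dB))
            (chanBn U (k + l) ρ))
          (Matrix.kroneckerMap (· * ·) (chanBn U k ρk) (chanBn U l ρl))
        - relEntropy
          (Matrix.reindex (splitEquiv k l (Fin dE)) (splitEquiv k l (Fin dE))
            (chanEn U (k + l) ρ))
          (Matrix.kroneckerMap (· * ·) (chanEn U k ρk) (chanEn U l ρl)) := by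
  have hU' : (U.submatrix (Equiv.prodComm (Fin dE) (Fin dB)) id)ᴴ *
      (U.submatrix (Equiv.prodComm (Fin dE) (Fin dB)) id) = 1 := by
    rw [conjTranspose_submatrix, submatrix_mul_equiv, hU, submatrix_id_id]
  have h1 := aux_B U hU k l ρ hρ.1 ρk ρl hρk hρl
  have h2 := aux_B _ hU' k l ρ hρ.1 ρk ρl hρk hρl
  simp only [← aux_E] at h2
  refine ⟨h1.1, h2.1, ?_⟩
  rw [h1.2, h2.2, cohInfoN, cohInfoN, cohInfoN]
  ring

end
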